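/- For every real number α̂ with α̂ > α_ν, one has lim_{x→0⁺} x^{α̂−2} ∫₀^x z² ν(dz) = 0. -/

import Mathlib

open MeasureTheory Filter Set

/-- A halving inequality `G x ≤ G (x / 2) + C x ^ s` near `0`, for a function vanishing at `0⁺`,
forces `G` to be bounded by a multiple of `x ^ s`. -/
theorem exists_le_mul_rpow_of_le_half_add {G : ℝ → ℝ} {C s δ : ℝ} (hs : 0 < s)
    (hG0 : Tendsto G (nhdsWithin 0 (Ioi 0)) (nhds 0))
    (hG : ∀ x, 0 < x → x < δ → G x ≤ G (x / 2) + C * x ^ s) :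
    ∃ K : ℝ, ∀ x, 0 < x → x < δ → G x ≤ K * x ^ s := by
  have hr : (1 / 2 : ℝ) ^ s < 1 := Real.rpow_lt_one (by norm_num) (by norm_num) hs
  refine ⟨C / (1 - (1 / 2 : ℝ) ^ s), fun x hx hxδ => ?_⟩
  set K := C / (1 - (1 / 2 : ℝ) ^ s) with hK
  have hKC : K - K * (1 / 2 : ℝ) ^ s = C := by
    rw [← mul_one_sub, hK]
    exact div_mul_cancel₀ C (sub_pos.2 hr).ne'
  have hstep : ∀ y, 0 < y → y < δ → G y - K * y ^ s ≤ G (y / 2) - K * (y / 2) ^ s := by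
    intro y hy hyδ
    have h1 : (y / 2) ^ s = y ^ s * (1 / 2 : ℝ) ^ s := by
      rw [← Real.mul_rpow hy.le (by norm_num)]
      congr 1
      ring
    have h2 := hG y hy hyδ
    rw [← hKC] at h2
    rw [h1]
    linarith
  have hpos : ∀ n : ℕ, 0 < x * (1 / 2 : ℝ) ^ n := fun n => by positivity
  have hiter : ∀ n : ℕ, G x - K * x ^ s ≤
      G (x * (1 / 2 : ℝ) ^ n) - K * (x * (1 / 2 : ℝ) ^ n) ^ s := by
    intro n
    induction n with
    | zero => simp
    | succ n ih =>
      have hlt : x * (1 / 2 : ℝ) ^ n < δ :=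
        (mul_le_of_le_one_right hx.le (pow_le_one₀ (by norm_num) (by norm_num))).trans_lt hxδ
      have h := hstep _ (hpos n) hlt
      have he : x * (1 / 2 : ℝ) ^ n / 2 = x * (1 / 2 : ℝ) ^ (n + 1) := by
        rw [pow_succ]
        ring
      rw [he] at h
      exact ih.trans h
  have hlim : Tendsto (fun n : ℕ => x * (1 / 2 : ℝ) ^ n) atTop (nhds 0) := by
    simpa using (tendsto_pow_atTop_nhds_zero_of_lt_one (r := (1 / 2 : ℝ))
      (by norm_num) (by norm_num)).const_mul x
  have hlim' : Tendsto (fun n : ℕ => x * (1 / 2 : ℝ) ^ n) atTop (nhdsWithin 0 (Ioi 0)) :=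
    tendsto_nhdsWithin_iff.2 ⟨hlim, Eventually.of_forall hpos⟩
  have hpow : Tendsto (fun n : ℕ => (x * (1 / 2 : ℝ) ^ n) ^ s) atTop (nhds 0) := by
    simpa [Real.zero_rpow hs.ne'] using hlim.rpow_const (p := s) (Or.inr hs.le)
  have hfin := (hG0.comp hlim').sub (hpow.const_mul K)
  have := ge_of_tendsto' hfin hiter
  linarith

theorem tendsto_rpow_nhdsGT_zero {s : ℝ} (hs : 0 < s) :
    Tendsto (fun x : ℝ => x ^ s) (nhdsWithin 0 (Ioi 0)) (nhds 0) := by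
  have h := (Real.continuousAt_rpow_const 0 s (Or.inr hs.le)).tendsto
  rw [Real.zero_rpow hs.ne'] at h
  exact h.mono_left nhdsWithin_le_nhds

section LevyMeasure

variable {ν : Measure ℝ}

theorem integrableOn_min_sq
    (hν : (∫⁻ z in Ioi (0 : ℝ), ENNReal.ofReal (min z (z ^ 2)) ∂ν) < ⊤) :
    IntegrableOn (fun z : ℝ => min z (z ^ 2)) (Ioi 0) ν := by
  refine ⟨by fun_prop, ?_⟩
  rw [hasFiniteIntegral_iff_ofReal]
  · exact hν
  · filter_upwards [ae_restrict_mem measurableSet_Ioi] with z hz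
    exact le_min (le_of_lt hz) (sq_nonneg z)

theorem mul_le_min_sq {x z : ℝ} (hx : 0 < x) (hx1 : x ≤ 1) (hz : x ≤ z) :
    x * z ≤ min z (z ^ 2) :=
  le_min (by nlinarith) (by nlinarith)

theorem sq_eq_min_sq {z : ℝ} (hz : 0 ≤ z) (hz1 : z ≤ 1) : z ^ 2 = min z (z ^ 2) :=
  (min_eq_right (by nlinarith)).symm

theorem integrableOn_id_Ioi
    (hm : IntegrableOn (fun z : ℝ => min z (z ^ 2)) (Ioi 0) ν)
    {x : ℝ} (hx : 0 < x) (hx1 : x ≤ 1) :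
    IntegrableOn (fun z : ℝ => z) (Ioi x) ν := by
  refine Integrable.mono' ((hm.mono_set (Ioi_subset_Ioi hx.le)).const_mul x⁻¹) (by fun_prop) ?_
  filter_upwards [ae_restrict_mem measurableSet_Ioi] with z hz
  have hz' : x < z := hz
  rw [Real.norm_of_nonneg (hx.trans hz').le, ← div_eq_inv_mul, le_div_iff₀ hx, mul_comm]
  exact mul_le_min_sq hx hx1 hz'.le

theorem integrableOn_sq_Ioc
    (hm : IntegrableOn (fun z : ℝ => min z (z ^ 2)) (Ioi 0) ν)
    {x : ℝ} (hx1 : x ≤ 1) :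
    IntegrableOn (fun z : ℝ => z ^ 2) (Ioc 0 x) ν :=
  (hm.mono_set Ioc_subset_Ioi_self).congr_fun
    (fun _ hz => (sq_eq_min_sq hz.1.le (hz.2.trans hx1)).symm) measurableSet_Ioc

theorem mul_integral_Ioi_le
    (hm : IntegrableOn (fun z : ℝ => min z (z ^ 2)) (Ioi 0) ν)
    {x : ℝ} (hx : 0 < x) (hx1 : x ≤ 1) :
    x * ∫ z in Ioi x, z ∂ν ≤ ∫ z in Ioi 0, min z (z ^ 2) ∂ν := by
  rw [← integral_const_mul]
  calc ∫ z in Ioi x, x * z ∂ν ≤ ∫ z in Ioi x, min z (z ^ 2) ∂ν :=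
        setIntegral_mono_on ((integrableOn_id_Ioi hm hx hx1).const_mul x)
          (hm.mono_set (Ioi_subset_Ioi hx.le)) measurableSet_Ioi
          fun z hz => mul_le_min_sq hx hx1 (le_of_lt hz)
    _ ≤ _ := by
        refine setIntegral_mono_set hm ?_ (Ioi_subset_Ioi hx.le).eventuallyLE
        filter_upwards [ae_restrict_mem measurableSet_Ioi] with z hz
        exact le_min (le_of_lt hz) (sq_nonneg z)

theorem tendsto_sq_mul_integral_Ioi
    (hm : IntegrableOn (fun z : ℝ => min z (z ^ 2)) (Ioi 0) ν) :
    Tendsto (fun x : ℝ => x ^ ((3 : ℝ) - 1) * ∫ z in Ioi x, z ∂ν)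
      (nhdsWithin 0 (Ioi 0)) (nhds 0) := by
  have hx0 : Tendsto (fun x : ℝ => x) (nhdsWithin 0 (Ioi 0)) (nhds 0) :=
    tendsto_id.mono_left nhdsWithin_le_nhds
  have hub : Tendsto (fun x : ℝ => x * ∫ z in Ioi 0, min z (z ^ 2) ∂ν)
      (nhdsWithin 0 (Ioi 0)) (nhds 0) := by
    simpa using hx0.mul_const (∫ z in Ioi 0, min z (z ^ 2) ∂ν)
  refine tendsto_of_tendsto_of_tendsto_of_le_of_le' tendsto_const_nhds hub ?_ ?_
  · filter_upwards [self_mem_nhdsWithin] with x hx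
    have hx' : 0 < x := hx
    exact mul_nonneg (Real.rpow_nonneg hx'.le _)
      (setIntegral_nonneg measurableSet_Ioi fun z hz => (hx'.trans hz).le)
  · filter_upwards [Ioo_mem_nhdsGT (zero_lt_one' ℝ)] with x hx
    have he : x ^ ((3 : ℝ) - 1) = x * x := by
      rw [show (3 : ℝ) - 1 = (2 : ℕ) by norm_num, Real.rpow_natCast, sq]
    rw [he, mul_assoc]
    exact mul_le_mul_of_nonneg_left (mul_integral_Ioi_le hm hx.1 hx.2.le) hx.1.le

theorem tendsto_integral_sq_Ioc
    (hm : IntegrableOn (fun z : ℝ => min z (z ^ 2)) (Ioi 0) ν) :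
    Tendsto (fun x : ℝ => ∫ z in Ioc 0 x, z ^ 2 ∂ν) (nhdsWithin 0 (Ioi 0)) (nhds 0) := by
  have h : Tendsto (fun x : ℝ => ∫ z in Ioi 0, (Iic x).indicator (fun z => min z (z ^ 2)) z ∂ν)
      (nhdsWithin 0 (Ioi 0)) (nhds (∫ _ in Ioi (0 : ℝ), (0 : ℝ) ∂ν)) := by
    refine tendsto_integral_filter_of_dominated_convergence (fun z => min z (z ^ 2)) ?_ ?_ hm ?_
    · exact Eventually.of_forall fun x => hm.aestronglyMeasurable.indicator measurableSet_Iic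
    · refine Eventually.of_forall fun x => ?_
      filter_upwards [ae_restrict_mem measurableSet_Ioi] with z hz
      have hz0 : 0 ≤ min z (z ^ 2) := le_min (le_of_lt hz) (sq_nonneg z)
      exact (norm_indicator_le_norm_self _ _).trans (Real.norm_of_nonneg hz0).le
    · filter_upwards [ae_restrict_mem measurableSet_Ioi] with z hz
      refine tendsto_const_nhds.congr' ?_
      filter_upwards [Ioo_mem_nhdsGT (show (0 : ℝ) < z from hz)] with x hx
      rw [indicator_of_notMem]
      exact not_le.2 hx.2
  rw [integral_zero] at h
  refine h.congr' ?_
  filter_upwards [Ioo_mem_nhdsGT (zero_lt_one' ℝ)] with x hx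
  rw [setIntegral_indicator measurableSet_Iic, Ioi_inter_Iic]
  exact setIntegral_congr_fun measurableSet_Ioc
    fun z hz => (sq_eq_min_sq hz.1.le (hz.2.trans hx.2.le)).symm

theorem integral_sq_Ioc_le_half_add
    (hm : IntegrableOn (fun z : ℝ => min z (z ^ 2)) (Ioi 0) ν)
    {x : ℝ} (hx : 0 < x) (hx1 : x ≤ 1) :
    ∫ z in Ioc 0 x, z ^ 2 ∂ν ≤
      ∫ z in Ioc 0 (x / 2), z ^ 2 ∂ν + x * ∫ z in Ioi (x / 2), z ∂ν := by
  have hx2 : 0 < x / 2 := half_pos hx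
  have hle : x / 2 ≤ x := half_le_self hx.le
  have hint := integrableOn_sq_Ioc hm hx1
  have hid := integrableOn_id_Ioi hm hx2 (hle.trans hx1)
  rw [← Ioc_union_Ioc_eq_Ioc hx2.le hle,
    setIntegral_union (Ioc_disjoint_Ioc_of_le le_rfl) measurableSet_Ioc
      (hint.mono_set (Ioc_subset_Ioc_right hle)) (hint.mono_set (Ioc_subset_Ioc_left hx2.le)),
    ← integral_const_mul]
  gcongr
  calc ∫ z in Ioc (x / 2) x, z ^ 2 ∂ν ≤ ∫ z in Ioc (x / 2) x, x * z ∂ν :=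
        setIntegral_mono_on (hint.mono_set (Ioc_subset_Ioc_left hx2.le))
          ((hid.mono_set Ioc_subset_Ioi_self).const_mul x) measurableSet_Ioc
          fun z hz => by
            rw [sq]
            exact mul_le_mul_of_nonneg_right hz.2 (hx2.trans hz.1).le
    _ ≤ _ := by
        refine setIntegral_mono_set (hid.const_mul x) ?_ Ioc_subset_Ioi_self.eventuallyLE
        filter_upwards [ae_restrict_mem measurableSet_Ioi] with z hz
        exact mul_nonneg hx.le (hx2.trans hz).le

theorem exists_integral_sq_Ioc_le_mul_rpow
    (hm : IntegrableOn (fun z : ℝ => min z (z ^ 2)) (Ioi 0) ν)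
    {b : ℝ} (hb : b < 2)
    (hT : Tendsto (fun x : ℝ => x ^ (b - 1) * ∫ z in Ioi x, z ∂ν)
      (nhdsWithin 0 (Ioi 0)) (nhds 0)) :
    ∃ δ > 0, ∃ K : ℝ, ∀ x, 0 < x → x < δ → ∫ z in Ioc 0 x, z ^ 2 ∂ν ≤ K * x ^ (2 - b) := by
  obtain ⟨ε, hε, hsub⟩ := mem_nhdsGT_iff_exists_Ioo_subset.1 (hT.eventually_lt_const one_pos)
  refine ⟨min ε 1, lt_min hε one_pos, exists_le_mul_rpow_of_le_half_add
    (C := (1 / 2 : ℝ) ^ (1 - b)) (sub_pos.2 hb) (tendsto_integral_sq_Ioc hm)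
    fun x hx hxδ => (integral_sq_Ioc_le_half_add hm hx (hxδ.le.trans (min_le_right _ _))).trans ?_⟩
  have hx2 : 0 < x / 2 := half_pos hx
  have h1 : (x / 2) ^ (b - 1) * ∫ z in Ioi (x / 2), z ∂ν < 1 :=
    hsub ⟨hx2, (half_lt_self hx).trans (hxδ.trans_le (min_le_left _ _))⟩
  have h2 : ∫ z in Ioi (x / 2), z ∂ν ≤ (x / 2) ^ (1 - b) := by
    rw [← neg_sub b 1, Real.rpow_neg hx2.le, ← one_div, le_div_iff₀ (Real.rpow_pos_of_pos hx2 _),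
      mul_comm]
    exact h1.le
  have h3 : x * (x / 2) ^ (1 - b) = (1 / 2 : ℝ) ^ (1 - b) * x ^ (2 - b) := by
    rw [div_eq_mul_one_div x, Real.mul_rpow hx.le (by norm_num),
      show (2 : ℝ) - b = 1 + (1 - b) by ring, Real.rpow_add hx, Real.rpow_one]
    ring
  rw [← h3]
  gcongr

end LevyMeasure

theorem statement14
    (ν : MeasureTheory.Measure ℝ) (hν0 : ν (Set.Iic (0:ℝ)) = 0)
    (hνfin : (∫⁻ z in Set.Ioi (0:ℝ), ENNReal.ofReal (min z (z^2)) ∂ν) < ⊤) :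
    ∀ a : ℝ,
      sInf {b : ℝ | 1 < b ∧ Filter.Tendsto
        (fun x : ℝ => x ^ (b - 1) * ∫ z in Set.Ioi x, z ∂ν)
        (nhdsWithin 0 (Set.Ioi 0)) (nhds 0)} < a →
      Filter.Tendsto (fun x : ℝ => x ^ (a - 2) * ∫ z in Set.Ioc (0:ℝ) x, z ^ 2 ∂ν)
        (nhdsWithin 0 (Set.Ioi 0)) (nhds 0) := by
  intro a ha
  have hm := integrableOn_min_sq hνfin
  have hnonneg : ∀ x : ℝ, 0 ≤ ∫ z in Ioc (0 : ℝ) x, z ^ 2 ∂ν := fun x =>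
    integral_nonneg fun z => sq_nonneg z
  have hlower : ∀ᶠ x in nhdsWithin (0 : ℝ) (Ioi 0),
      0 ≤ x ^ (a - 2) * ∫ z in Ioc (0 : ℝ) x, z ^ 2 ∂ν := by
    filter_upwards [self_mem_nhdsWithin] with x hx
    exact mul_nonneg (Real.rpow_nonneg (le_of_lt hx) _) (hnonneg x)
  rcases le_or_gt 2 a with h2 | h2
  · refine tendsto_of_tendsto_of_tendsto_of_le_of_le' tendsto_const_nhds
      (tendsto_integral_sq_Ioc hm) hlower ?_
    filter_upwards [Ioo_mem_nhdsGT (zero_lt_one' ℝ)] with x hx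
    exact mul_le_of_le_one_left (hnonneg x)
      (Real.rpow_le_one hx.1.le hx.2.le (sub_nonneg.2 h2))
  · obtain ⟨b, ⟨-, hT⟩, hba⟩ := exists_lt_of_csInf_lt
      (by exact ⟨3, by norm_num, tendsto_sq_mul_integral_Ioi hm⟩) ha
    obtain ⟨δ, hδ, K, hK⟩ := exists_integral_sq_Ioc_le_mul_rpow hm (hba.trans h2) hT
    have hub : Tendsto (fun x : ℝ => K * x ^ (a - b)) (nhdsWithin 0 (Ioi 0)) (nhds 0) := by
      simpa using (tendsto_rpow_nhdsGT_zero (sub_pos.2 hba)).const_mul K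
    refine tendsto_of_tendsto_of_tendsto_of_le_of_le' tendsto_const_nhds hub hlower ?_
    filter_upwards [Ioo_mem_nhdsGT hδ] with x hx
    calc x ^ (a - 2) * ∫ z in Ioc (0 : ℝ) x, z ^ 2 ∂ν
        ≤ x ^ (a - 2) * (K * x ^ (2 - b)) :=
          mul_le_mul_of_nonneg_left (hK x hx.1 hx.2) (Real.rpow_nonneg hx.1.le _)
      _ = K * x ^ (a - b) := by
          rw [show a - b = (a - 2) + (2 - b) by ring, Real.rpow_add hx.1]
          ring
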